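/- For every i ∈ {1,...,5}, A_i is anticomplete to S2. -/

import Mathlib

open SimpleGraph

/-- The disjoint union `P2 ∪ P3`: an edge 0-1 together with a path 2-3-4. -/
def p2p3 : SimpleGraph (Fin 5) :=
  SimpleGraph.fromEdgeSet {s(0,1), s(2,3), s(3,4)}

variable {V : Type*}

/-- `S0` is the vertex set of the induced 5-cycle. -/
def S0 (v : Fin 5 → V) : Set V := Set.range v

/-- `Aset H v i` is the set of vertices outside `S0` whose neighborhood in `S0`
is exactly `{v i}`. -/
def Aset (H : SimpleGraph V) (v : Fin 5 → V) (i : Fin 5) : Set V :=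
  {x | x ∉ S0 v ∧ ∀ j : Fin 5, H.Adj x (v j) ↔ j = i}

/-- `Bset H v i` is the set of vertices outside `S0` whose neighborhood in `S0`
is exactly `{v (i-1), v (i+1)}`. -/
def Bset (H : SimpleGraph V) (v : Fin 5 → V) (i : Fin 5) : Set V :=
  {x | x ∉ S0 v ∧ ∀ j : Fin 5, H.Adj x (v j) ↔ (j = i - 1 ∨ j = i + 1)}

/-- `S2set H v` is the set of vertices at distance exactly 2 from `S0`: vertices outside `S0`
with no neighbor in `S0` but with a neighbor having a neighbor in `S0`. -/
def S2set (H : SimpleGraph V) (v : Fin 5 → V) : Set V :=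
  {x | x ∉ S0 v ∧ (∀ j : Fin 5, ¬ H.Adj x (v j)) ∧
    ∃ y, H.Adj x y ∧ ∃ j : Fin 5, H.Adj y (v j)}

/-- `S` is complete to `T`: every vertex of `S` is adjacent to every vertex of `T`. -/
def Complete (H : SimpleGraph V) (S T : Set V) : Prop := ∀ x ∈ S, ∀ y ∈ T, H.Adj x y

/-- `S` is anticomplete to `T`: there are no edges between `S` and `T`. -/
def Anticomplete (H : SimpleGraph V) (S T : Set V) : Prop := ∀ x ∈ S, ∀ y ∈ T, ¬ H.Adj x y

/-- `hA` is the number of indices `i` with `A_i` nonempty. -/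
noncomputable def hA (H : SimpleGraph V) (v : Fin 5 → V) : ℕ :=
  {i : Fin 5 | (Aset H v i).Nonempty}.ncard

/-- `hB` is the number of indices `i` with `B_i` nonempty. -/
noncomputable def hB (H : SimpleGraph V) (v : Fin 5 → V) : ℕ :=
  {i : Fin 5 | (Bset H v i).Nonempty}.ncard

/-- An induced copy of `P2 ∪ P3`, given by an edge `a b` anticomplete to an induced path
`c d e`. -/
theorem nonempty_p2p3_embedding {V : Type*} {H : SimpleGraph V} {a b c d e : V}
    (hab : H.Adj a b) (hcd : H.Adj c d) (hde : H.Adj d e) (hce : ¬ H.Adj c e) (hne : c ≠ e)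
    (hac : ¬ H.Adj a c) (had : ¬ H.Adj a d) (hae : ¬ H.Adj a e)
    (hbc : ¬ H.Adj b c) (hbd : ¬ H.Adj b d) (hbe : ¬ H.Adj b e) :
    Nonempty (p2p3 ↪g H) := by
  have hca : c ≠ a := by rintro rfl; exact had hcd
  have hcb : c ≠ b := by rintro rfl; exact hac hab
  have hda : d ≠ a := by rintro rfl; exact hae hde
  have hdb : d ≠ b := by rintro rfl; exact had hab
  have hea : e ≠ a := by rintro rfl; exact had hde.symm
  have heb : e ≠ b := by rintro rfl; exact hae hab
  refine ⟨⟨⟨![a, b, c, d, e], ?_⟩, ?_⟩⟩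
  · intro i j h
    fin_cases i <;> fin_cases j <;>
      simp_all [hab.ne, hab.ne', hcd.ne, hcd.ne', hde.ne, hde.ne', hne.symm, hca.symm, hcb.symm,
        hda.symm, hdb.symm, hea.symm, heb.symm]
  · intro i j
    change H.Adj (![a, b, c, d, e] i) (![a, b, c, d, e] j) ↔ p2p3.Adj i j
    fin_cases i <;> fin_cases j <;>
      simp [p2p3, hab, hab.symm, hcd, hcd.symm, hde, hde.symm, hce, hac, had, hae, hbc, hbd, hbe,
        H.adj_comm e c, H.adj_comm c a, H.adj_comm d a, H.adj_comm e a, H.adj_comm c b,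
        H.adj_comm d b, H.adj_comm e b]

theorem stmt11 {V : Type*} [Fintype V] (H : SimpleGraph V) (v : Fin 5 → V)
    (hinj : Function.Injective v)
    (hC5 : ∀ i j : Fin 5, H.Adj (v i) (v j) ↔ (j = i + 1 ∨ i = j + 1))
    (htriangle : H.CliqueFree 3)
    (hP2P3 : ¬ Nonempty (p2p3 ↪g H))
    : ∀ i : Fin 5, Anticomplete H (Aset H v i) (S2set H v) := by
  rintro i x ⟨-, hx⟩ y ⟨-, hy, -⟩ hxy
  refine hP2P3 (nonempty_p2p3_embedding (c := v (i + 1)) (d := v (i + 2)) (e := v (i + 3)) hxy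
    ?_ ?_ ?_ ?_ ?_ ?_ ?_ (hy _) (hy _) (hy _))
  all_goals simp only [hC5, hx, hinj.ne_iff]
  all_goals clear hx; revert i; decide
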